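/- The encoding ⟦·⟧ᵐₐ from the π-calculus with mixed choice into the asynchronous π-calculus is name invariant: for every source term S of πₘ and every substitution σ on names there exists a substitution σ' such that φᵐₐ(σ(n)) = σ'(φᵐₐ(n)) for every name n, and ⟦σ(S)⟧ᵐₐ is alpha-equivalent to σ'(⟦S⟧ᵐₐ). -/

import Mathlib

set_option autoImplicit true
set_option relaxedAutoImplicit true
set_option maxHeartbeats 1000000

namespace PiCalc

/-! # The π-calculi πₘ (mixed choice), πₛ (separate choice) and πₐ (asynchronous)

Formalization of the setting of Peters/Nestmann, "On the Expressiveness of Mixed Choice"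
(technical report).  Names are natural numbers; a single syntax covers all three calculi,
with subcalculi carved out by predicates.  Sums are built from the empty sum `nil`,
guarded terms and binary `choice`. -/

abbrev Name : Type := ℕ

inductive Proc : Type
  | nil : Proc                               -- empty sum 0
  | succ : Proc                              -- success ✓
  | res : Name → Proc → Proc                 -- (νx)P
  | par : Proc → Proc → Proc                 -- P | Q
  | mat : Name → Name → Proc → Proc          -- [a = b]P
  | inp : Name → List Name → Proc → Proc     -- y(x̃).P
  | out : Name → List Name → Proc → Proc     -- ȳ⟨z̃⟩.P  (asynchronous output: continuation nil)
  | rep : Name → List Name → Proc → Proc     -- y*(x̃).P (replicated input)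
  | tau : Proc → Proc                        -- τ.P
  | choice : Proc → Proc → Proc              -- P + Q
  deriving DecidableEq

/-- Free names of a process. -/
def freeNames : Proc → Finset Name
  | .nil => ∅
  | .succ => ∅
  | .res x P => freeNames P \ {x}
  | .par P Q => freeNames P ∪ freeNames Q
  | .mat a b P => insert a (insert b (freeNames P))
  | .inp y xs P => insert y (freeNames P \ xs.toFinset)
  | .out y zs P => insert y (zs.toFinset ∪ freeNames P)
  | .rep y xs P => insert y (freeNames P \ xs.toFinset)
  | .tau P => freeNames P
  | .choice P Q => freeNames P ∪ freeNames Q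

/-- All names (free or bound) occurring in a process. -/
def allNames : Proc → Finset Name
  | .nil => ∅
  | .succ => ∅
  | .res x P => insert x (allNames P)
  | .par P Q => allNames P ∪ allNames Q
  | .mat a b P => insert a (insert b (allNames P))
  | .inp y xs P => insert y (xs.toFinset ∪ allNames P)
  | .out y zs P => insert y (zs.toFinset ∪ allNames P)
  | .rep y xs P => insert y (xs.toFinset ∪ allNames P)
  | .tau P => allNames P
  | .choice P Q => allNames P ∪ allNames Q

/-! ## Alpha-equivalence, via a de Bruijn normal form -/

inductive DBName : Type
  | free : Name → DBName
  | bound : ℕ → DBName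
  deriving DecidableEq

inductive DB : Type
  | nil : DB
  | succ : DB
  | res : DB → DB
  | par : DB → DB → DB
  | mat : DBName → DBName → DB → DB
  | inp : DBName → ℕ → DB → DB
  | out : DBName → List DBName → DB → DB
  | rep : DBName → ℕ → DB → DB
  | tau : DB → DB
  | choice : DB → DB → DB
  deriving DecidableEq

def dbVar (env : List Name) (x : Name) : DBName :=
  match env.findIdx? (· == x) with
  | some i => .bound i
  | none => .free x

def toDB : List Name → Proc → DB
  | _, .nil => .nil
  | _, .succ => .succ
  | env, .res x P => .res (toDB (x :: env) P)
  | env, .par P Q => .par (toDB env P) (toDB env Q)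
  | env, .mat a b P => .mat (dbVar env a) (dbVar env b) (toDB env P)
  | env, .inp y xs P => .inp (dbVar env y) xs.length (toDB (xs.reverse ++ env) P)
  | env, .out y zs P => .out (dbVar env y) (zs.map (dbVar env)) (toDB env P)
  | env, .rep y xs P => .rep (dbVar env y) xs.length (toDB (xs.reverse ++ env) P)
  | env, .tau P => .tau (toDB env P)
  | env, .choice P Q => .choice (toDB env P) (toDB env Q)

/-- `P` and `Q` are alpha-equivalent (differ only in the choice of bound names). -/
def AlphaEq (P Q : Proc) : Prop := toDB [] P = toDB [] Q

/-! ## Capture-avoiding substitution -/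

def freshName (avoid : Finset Name) : Name := avoid.sup id + 1

def freshNames : Finset Name → ℕ → List Name
  | _, 0 => []
  | avoid, n + 1 => freshName avoid :: freshNames (insert (freshName avoid) avoid) n

/-- Simultaneous update of a substitution on lists of names. -/
def updates (σ : Name → Name) : List Name → List Name → Name → Name
  | x :: xs, z :: zs => Function.update (updates σ xs zs) x z
  | _, _ => σ

def applySubstAux : (Name → Name) → Finset Name → Proc → Proc
  | _, _, .nil => .nil
  | _, _, .succ => .succ
  | σ, avoid, .res x P =>
      let x' := freshName avoid
      .res x' (applySubstAux (Function.update σ x x') (insert x' avoid) P)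
  | σ, avoid, .par P Q => .par (applySubstAux σ avoid P) (applySubstAux σ avoid Q)
  | σ, avoid, .mat a b P => .mat (σ a) (σ b) (applySubstAux σ avoid P)
  | σ, avoid, .inp y xs P =>
      let xs' := freshNames avoid xs.length
      .inp (σ y) xs' (applySubstAux (updates σ xs xs') (avoid ∪ xs'.toFinset) P)
  | σ, avoid, .out y zs P => .out (σ y) (zs.map σ) (applySubstAux σ avoid P)
  | σ, avoid, .rep y xs P =>
      let xs' := freshNames avoid xs.length
      .rep (σ y) xs' (applySubstAux (updates σ xs xs') (avoid ∪ xs'.toFinset) P)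
  | σ, avoid, .tau P => .tau (applySubstAux σ avoid P)
  | σ, avoid, .choice P Q => .choice (applySubstAux σ avoid P) (applySubstAux σ avoid Q)

/-- Application `σ(P)` of a substitution to a process, silently alpha-converting
all binders to avoid capture and name clashes. -/
def applySubst (σ : Name → Name) (P : Proc) : Proc :=
  applySubstAux σ (allNames P ∪ (allNames P).image σ) P

/-- For an injective renaming policy `φ`, the substitution
`φ(σ) = {φ(y₁)/φ(x₁), …, φ(yₙ)/φ(xₙ)}` induced by `σ = {y₁/x₁, …, yₙ/xₙ}`. -/
noncomputable def mapSubst (φ σ : Name → Name) : Name → Name :=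
  fun m =>
    letI := Classical.propDecidable (∃ n, φ n = m)
    if h : ∃ n, φ n = m then φ (σ (Classical.choose h)) else m

def resList : List Name → Proc → Proc
  | [], P => P
  | x :: xs, P => .res x (resList xs P)

def parList : List Proc → Proc
  | [] => .nil
  | [P] => P
  | P :: Ps => .par P (parList Ps)

/-! ## Structural congruence (Figure 1); the flag `true` additionally allows
splitting of replicated inputs (`≡ᵣₑₚ`). -/

inductive StructCongX : Bool → Proc → Proc → Prop
  | alpha {b : Bool} {P Q : Proc} : AlphaEq P Q → StructCongX b P Q
  | parNil {b : Bool} {P : Proc} : StructCongX b (.par P .nil) P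
  | parComm {b : Bool} {P Q : Proc} : StructCongX b (.par P Q) (.par Q P)
  | parAssoc {b : Bool} {P Q R : Proc} :
      StructCongX b (.par P (.par Q R)) (.par (.par P Q) R)
  | matElim {b : Bool} {a : Name} {P : Proc} : StructCongX b (.mat a a P) P
  | resNil {b : Bool} {n : Name} : StructCongX b (.res n .nil) .nil
  | resSwap {b : Bool} {n m : Name} {P : Proc} :
      StructCongX b (.res n (.res m P)) (.res m (.res n P))
  | resPar {b : Bool} {n : Name} {P Q : Proc} :
      n ∉ freeNames P → StructCongX b (.par P (.res n Q)) (.res n (.par P Q))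
  | repSplit {y : Name} {xs : List Name} {P : Proc} :
      StructCongX true (.rep y xs P) (.par (.rep y xs P) (.rep y xs P))
  | refl {b : Bool} {P : Proc} : StructCongX b P P
  | symm {b : Bool} {P Q : Proc} : StructCongX b P Q → StructCongX b Q P
  | trans {b : Bool} {P Q R : Proc} :
      StructCongX b P Q → StructCongX b Q R → StructCongX b P R
  | resCong {b : Bool} {x : Name} {P Q : Proc} :
      StructCongX b P Q → StructCongX b (.res x P) (.res x Q)
  | parCong {b : Bool} {P P' Q Q' : Proc} :
      StructCongX b P P' → StructCongX b Q Q' → StructCongX b (.par P Q) (.par P' Q')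

/-- Structural congruence `≡`. -/
abbrev StructCong : Proc → Proc → Prop := StructCongX false
/-- Structural congruence `≡ᵣₑₚ` extended by `y*(x̃).P ≡ y*(x̃).P | y*(x̃).P`. -/
abbrev StructCongRep : Proc → Proc → Prop := StructCongX true

/-! ## Reduction semantics (Figure 2 of the preliminaries) -/

/-- `IsSummand G S`: the (guarded) term `G` occurs as a summand of the sum `S`. -/
inductive IsSummand : Proc → Proc → Prop
  | refl (P : Proc) : IsSummand P P
  | left {P Q R : Proc} : IsSummand P Q → IsSummand P (.choice Q R)
  | right {P Q R : Proc} : IsSummand P R → IsSummand P (.choice Q R)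

/-- Labelled reduction: the label records the channel of the interaction
(`none` for a step of a τ-guarded summand). -/
inductive LabStep : Proc → Option Name → Proc → Prop
  | tauStep {P S : Proc} : IsSummand (.tau P) S → LabStep S none P
  | com {y : Name} {xs zs : List Name} {P Q S₁ S₂ : Proc} :
      xs.length = zs.length →
      IsSummand (.inp y xs P) S₁ → IsSummand (.out y zs Q) S₂ →
      LabStep (.par S₁ S₂) (some y) (.par (applySubst (updates id xs zs) P) Q)
  | repStep {y : Name} {xs zs : List Name} {P Q S : Proc} :
      xs.length = zs.length →
      IsSummand (.out y zs Q) S →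
      LabStep (.par (.rep y xs P) S) (some y)
        (.par (applySubst (updates id xs zs) P) (.par Q (.rep y xs P)))
  | parStep {P P' Q : Proc} {a : Option Name} :
      LabStep P a P' → LabStep (.par P Q) a (.par P' Q)
  | resStep {P P' : Proc} {x : Name} {a : Option Name} :
      LabStep P a P' → LabStep (.res x P) a (.res x P')
  | congr {P P' Q Q' : Proc} {a : Option Name} :
      StructCong P P' → LabStep P' a Q' → StructCong Q' Q → LabStep P a Q

/-- One reduction step `P ⟶ Q`. -/
def Reduces (P Q : Proc) : Prop := ∃ a, LabStep P a Q

/-- `P ⟹ Q`: reflexive-transitive closure of reduction. -/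
def Steps : Proc → Proc → Prop := Relation.ReflTransGen Reduces

/-- `P ⟶^ω`: `P` has an infinite sequence of reduction steps. -/
def Divergent (P : Proc) : Prop := ∃ f : ℕ → Proc, f 0 = P ∧ ∀ n, Reduces (f n) (f (n + 1))

/-- `P ⇓✓`: `P` may lead to success. -/
def reachSuccess (P : Proc) : Prop :=
  ∃ P' P'' : Proc, Steps P P' ∧ StructCong P' (.par P'' .succ)

/-! ## The subcalculi -/

mutual
  /-- `P` is a term of the π-calculus with mixed choice πₘ. -/
  inductive IsMix : Proc → Prop
    | succ : IsMix .succ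
    | res {x : Name} {P : Proc} : IsMix P → IsMix (.res x P)
    | par {P Q : Proc} : IsMix P → IsMix Q → IsMix (.par P Q)
    | mat {a c : Name} {P : Proc} : IsMix P → IsMix (.mat a c P)
    | rep {y x : Name} {P : Proc} : IsMix P → IsMix (.rep y [x] P)
    | sum {P : Proc} : IsMixSum P → IsMix P
  /-- `P` is a (possibly empty) mixed-choice sum of guarded πₘ terms. -/
  inductive IsMixSum : Proc → Prop
    | nil : IsMixSum .nil
    | inp {y x : Name} {P : Proc} : IsMix P → IsMixSum (.inp y [x] P)
    | out {y z : Name} {P : Proc} : IsMix P → IsMixSum (.out y [z] P)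
    | tau {P : Proc} : IsMix P → IsMixSum (.tau P)
    | choice {P Q : Proc} : IsMixSum P → IsMixSum Q → IsMixSum (.choice P Q)
end

mutual
  /-- `P` is a term of the π-calculus with separate choice πₛ. -/
  inductive IsSep : Proc → Prop
    | succ : IsSep .succ
    | res {x : Name} {P : Proc} : IsSep P → IsSep (.res x P)
    | par {P Q : Proc} : IsSep P → IsSep Q → IsSep (.par P Q)
    | mat {a c : Name} {P : Proc} : IsSep P → IsSep (.mat a c P)
    | rep {y x : Name} {P : Proc} : IsSep P → IsSep (.rep y [x] P)
    | sumIn {P : Proc} : IsSepIn P → IsSep P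
    | sumOut {P : Proc} : IsSepOut P → IsSep P
  /-- a sum all of whose guards are inputs or τ -/
  inductive IsSepIn : Proc → Prop
    | nil : IsSepIn .nil
    | inp {y x : Name} {P : Proc} : IsSep P → IsSepIn (.inp y [x] P)
    | tau {P : Proc} : IsSep P → IsSepIn (.tau P)
    | choice {P Q : Proc} : IsSepIn P → IsSepIn Q → IsSepIn (.choice P Q)
  /-- a sum all of whose guards are outputs or τ -/
  inductive IsSepOut : Proc → Prop
    | nil : IsSepOut .nil
    | out {y z : Name} {P : Proc} : IsSep P → IsSepOut (.out y [z] P)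
    | tau {P : Proc} : IsSep P → IsSepOut (.tau P)
    | choice {P Q : Proc} : IsSepOut P → IsSepOut Q → IsSepOut (.choice P Q)
end

/-- `P` is a term of the (polyadic) asynchronous π-calculus πₐ. -/
inductive IsAsync : Proc → Prop
  | nil : IsAsync .nil
  | succ : IsAsync .succ
  | res {x : Name} {P : Proc} : IsAsync P → IsAsync (.res x P)
  | par {P Q : Proc} : IsAsync P → IsAsync Q → IsAsync (.par P Q)
  | mat {a c : Name} {P : Proc} : IsAsync P → IsAsync (.mat a c P)
  | out {y : Name} {zs : List Name} : IsAsync (.out y zs .nil)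
  | inp {y : Name} {xs : List Name} {P : Proc} : IsAsync P → IsAsync (.inp y xs P)
  | tau {P : Proc} : IsAsync P → IsAsync (.tau P)
  | rep {y : Name} {xs : List Name} {P : Proc} : IsAsync P → IsAsync (.rep y xs P)

/-- A guarded πₘ term `π.P` (a potential summand). -/
def IsGuardedMix (g : Proc) : Prop :=
  match g with
  | .inp _ [_] P => IsMix P
  | .out _ [_] P => IsMix P
  | .tau P => IsMix P
  | _ => False

/-- A guarded πₛ term `π.P` (a potential summand). -/
def IsGuardedSep (g : Proc) : Prop :=
  match g with
  | .inp _ [_] P => IsSep P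
  | .out _ [_] P => IsSep P
  | .tau P => IsSep P
  | _ => False

/-! ## Reserved names, booleans and test-statements -/

def nT : Name := 0      -- t
def nF : Name := 1      -- f
def nL : Name := 2      -- sum lock l
def nL' : Name := 3     -- sum lock l'
def nS : Name := 4      -- sender lock s
def nR : Name := 5      -- receiver lock r
def nPo : Name := 6     -- request channel p_o
def nPi : Name := 7     -- request channel p_i
def nMo : Name := 8     -- m_o
def nMi : Name := 9     -- m_i
def nCo : Name := 10    -- c_o
def nCi : Name := 11    -- c_i
def nCmo : Name := 12   -- c_{m,o}
def nCmi : Name := 13   -- c_{m,i}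
def nMuo : Name := 14   -- m_{up,o}
def nMui : Name := 15   -- m_{up,i}
def nLs : Name := 16    -- l_s
def nLr : Name := 17    -- l_r
def nL1 : Name := 18    -- l₁
def nL2 : Name := 19    -- l₂
def nCr1 : Name := 20   -- c_{r,1}
def nCr2 : Name := 21   -- c_{r,2}
def nMri : Name := 22   -- m_{r,i}
def nMro : Name := 23   -- m_{r,o}
def nMrui : Name := 24  -- m_{r,up,i}
def nMruo : Name := 25  -- m_{r,up,o}
def nY : Name := 26     -- y
def nY' : Name := 27    -- y'
def nZ : Name := 28     -- z
def nDash : Name := 29  -- the wildcard "−"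
def argBase : Name := 30

/-- The renaming policy φˢₐ: an injective substitution translating every source term
name into a single name different from all reserved names. -/
def phiSA : Name → Name := fun n => n + 50

/-- The renaming policy φᵐₐ. -/
def phiMA : Name → Name := fun n => n + 50

/-- Boolean instantiation `l⟨⊤⟩ ≜ l(t,f).t̄`. -/
def lockTrue (l : Name) : Proc := .inp l [nT, nF] (.out nT [] .nil)

/-- Boolean instantiation `l⟨⊥⟩ ≜ l(t,f).f̄`. -/
def lockFalse (l : Name) : Proc := .inp l [nT, nF] (.out nF [] .nil)

/-- `l⟨b⟩` for a boolean value `b`. -/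
def lockOut (l : Name) (b : Bool) : Proc := if b then lockTrue l else lockFalse l

/-- `test l then P else Q ≜ (νt,f)(l⟨t,f⟩ | t.P | f.Q)`. -/
def test (l : Name) (P Q : Proc) : Proc :=
  .res nT (.res nF (.par (.out l [nT, nF] .nil) (.par (.inp nT [] P) (.inp nF [] Q))))

/-- reserved argument names for forwarders -/
def fwArgs (n : ℕ) : List Name := (List.range n).map (fun i => argBase + i)

/-- Forwarder `y ↠ {y₁, …, yₖ}` for channels of multiplicity `n`. -/
def forward (y : Name) (ys : List Name) (n : ℕ) : Proc :=
  .rep y (fwArgs n) (parList (ys.map fun yi => .out yi (fwArgs n) .nil))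

/-! ## The encoding ⟦·⟧ˢₐ of πₛ into πₐ (Figure 2 / Nestmann) -/

/-- Computes simultaneously the translation of a term and (for potential summands)
the translation of the summand as a function of the surrounding sum lock. -/
def encSAcore : Proc → Proc × (Name → Proc)
  | .nil => (.res nL (.par (lockTrue nL) .nil), fun _ => .nil)
  | .succ => (.succ, fun _ => .nil)
  | .res x P => (.res (phiSA x) (encSAcore P).1, fun _ => .nil)
  | .par P Q => (.par (encSAcore P).1 (encSAcore Q).1, fun _ => .nil)
  | .mat a b P => (.mat (phiSA a) (phiSA b) (encSAcore P).1, fun _ => .nil)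
  | .rep y xs P =>
      (.rep (phiSA y) ([nL, nS] ++ xs.map phiSA)
          (test nL (.par (lockFalse nL) (.par (.out nS [] .nil) (encSAcore P).1))
            (lockFalse nL)),
       fun _ => .nil)
  | .tau P =>
      let e := (encSAcore P).1
      let s := fun l => test l (.par (lockFalse l) e) (lockFalse l)
      (.res nL (.par (lockTrue nL) (s nL)), s)
  | .out y zs P =>
      let e := (encSAcore P).1
      let s := fun l =>
        .res nS (.par (.out (phiSA y) ([l, nS] ++ zs.map phiSA) .nil) (.inp nS [] e))
      (.res nL (.par (lockTrue nL) (s nL)), s)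
  | .inp y xs P =>
      let e := (encSAcore P).1
      let s := fun l =>
        .res nR (.par (.out nR [] .nil)
          (.rep nR []
            (.inp (phiSA y) ([nL', nS] ++ xs.map phiSA)
              (test l
                (test nL'
                  (.par (lockFalse l)
                    (.par (lockFalse nL') (.par (.out nS [] .nil) e)))
                  (.par (lockTrue l) (.par (lockFalse nL') (.out nR [] .nil))))
                (.par (lockFalse l)
                  (.out (phiSA y) ([nL', nS] ++ xs.map phiSA) .nil))))))
      (.res nL (.par (lockTrue nL) (s nL)), s)
  | .choice P Q =>
      let a := (encSAcore P).2
      let b := (encSAcore Q).2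
      (.res nL (.par (lockTrue nL) (.par (a nL) (b nL))), fun l => .par (a l) (b l))

/-- The encoding `⟦·⟧ˢₐ` from πₛ into πₐ. -/
def encSA (P : Proc) : Proc := (encSAcore P).1

/-- `⟦π.P⟧ˢₐ` of a summand, with `l` as the sum lock of the surrounding sum. -/
def encSASummand (l : Name) (g : Proc) : Proc := (encSAcore g).2 l

/-! ## The encoding ⟦·⟧ᵐₐ of πₘ into πₐ (Figure 3) -/

/-- processing of right output requests in the parallel-operator encoding -/
def procRightOut : Proc :=
  .par (.out nCmo [nMi] .nil)
    (.rep nCmo [nMi]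
      (.inp nPo [nY, nLs, nS, nZ]
        (.par
          (.res nMui
            (.par
              (.rep nMi [nY', nLr, nR]
                (.par (.mat nY' nY (.out nR [nLr, nLs, nLs, nS, nZ] .nil))
                      (.out nMui [nY', nLr, nR] .nil)))
              (.res nMi (.par (forward nMui [nMi] 3) (.out nCmo [nMi] .nil)))))
          (.out nCo [nY, nLs, nS, nZ] .nil))))

/-- processing of right input requests in the parallel-operator encoding -/
def procRightIn : Proc :=
  .par (.out nCmi [nMo] .nil)
    (.rep nCmi [nMo]
      (.inp nPi [nY, nLr, nR]
        (.par
          (.res nMuo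
            (.par
              (.rep nMo [nY', nLs, nS, nZ]
                (.par (.mat nY' nY (.out nR [nLs, nLr, nLs, nS, nZ] .nil))
                      (.out nMuo [nY', nLs, nS, nZ] .nil)))
              (.res nMo (.par (forward nMuo [nMo] 4) (.out nCmi [nMo] .nil)))))
          (.out nCi [nY, nLr, nR] .nil))))

def procLeftOut : Proc := forward nPo [nMo, nCo] 4
def procLeftIn : Proc := forward nPi [nMi, nCi] 3
def pushReqs : Proc := .par (forward nCo [nPo] 4) (forward nCi [nPi] 3)

/-- The context introduced by `⟦P | Q⟧ᵐₐ` around `⟦P⟧ᵐₐ` and `⟦Q⟧ᵐₐ`. -/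
def encMApar (EP EQ : Proc) : Proc :=
  resList [nMo, nMi, nCo, nCi, nCmo, nCmi]
    (parList
      [ .res nPo (.res nPi (parList [EP, procLeftOut, procLeftIn]))
      , .res nPo (.res nPi (parList [EQ, procRightOut, procRightIn]))
      , pushReqs ])

def pushReqsIn : Proc :=
  .par (forward nMro [nMo, nMruo] 4) (forward nMri [nMi, nMrui] 3)

def pushReqsOut : Proc :=
  parList
    [ .out nCr2 [nMro, nMri] .nil
    , forward nCo [nPo, nMro] 4
    , forward nMruo [nMro] 4
    , forward nCi [nPi, nMri] 3
    , forward nMrui [nMri] 3 ]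

/-- A branch of the replicated-input encoding around the encoded continuation `e`. -/
def encMAbranch (e : Proc) : Proc :=
  resList [nMo, nMi, nCo, nCi, nMruo, nMrui, nCmo, nCmi, nMuo, nMui]
    (parList
      [ pushReqsIn
      , .res nPo (.res nPi (parList [e, procRightOut, procRightIn]))
      , .res nMro (.res nMri pushReqsOut) ])

/-- `⟦y*(x).P⟧ᵐₐ`; here `y` and `pxs` are already translated by φᵐₐ and
`e` is the translation of the continuation. -/
def encMArep (y : Name) (pxs : List Name) (e : Proc) : Proc :=
  resList [nL, nR, nCr1, nCr2, nMro, nMri]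
    (parList
      [ .out nPi [y, nL, nR] .nil
      , .rep nR ([nDash, nDash, nLs, nS] ++ pxs)
          (test nLs
            (.par (lockFalse nLs) (.par (.out nS [] .nil) (.out nCr1 pxs .nil)))
            (lockFalse nLs))
      , .out nMri [y, nL, nR] .nil
      , lockTrue nL
      , .out nCr2 [nMro, nMri] .nil
      , .rep nCr1 pxs (.inp nCr2 [nMro, nMri] (encMAbranch e)) ])

def encMAcore : Proc → Proc × (Name → Proc)
  | .nil => (.res nL (.par (lockTrue nL) .nil), fun _ => .nil)
  | .succ => (.succ, fun _ => .nil)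
  | .res x P => (.res (phiMA x) (encMAcore P).1, fun _ => .nil)
  | .par P Q => (encMApar (encMAcore P).1 (encMAcore Q).1, fun _ => .nil)
  | .mat a b P => (.mat (phiMA a) (phiMA b) (encMAcore P).1, fun _ => .nil)
  | .rep y xs P => (encMArep (phiMA y) (xs.map phiMA) (encMAcore P).1, fun _ => .nil)
  | .tau P =>
      let e := (encMAcore P).1
      let s := fun l => test l (.par (lockFalse l) e) (lockFalse l)
      (.res nL (.par (lockTrue nL) (s nL)), s)
  | .out y zs P =>
      let e := (encMAcore P).1
      let s := fun l =>
        .res nS (.par (.out nPo ([phiMA y, l, nS] ++ zs.map phiMA) .nil) (.inp nS [] e))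
      (.res nL (.par (lockTrue nL) (s nL)), s)
  | .inp y xs P =>
      let e := (encMAcore P).1
      let s := fun l =>
        .res nR (.par (.out nPi [phiMA y, l, nR] .nil)
          (.rep nR ([nL1, nL2, nDash, nS] ++ xs.map phiMA)
            (test nL1
              (test nL2
                (.par (lockFalse nL1)
                  (.par (lockFalse nL2) (.par (.out nS [] .nil) e)))
                (.par (lockTrue nL1) (lockFalse nL2)))
              (lockFalse nL1))))
      (.res nL (.par (lockTrue nL) (s nL)), s)
  | .choice P Q =>
      let a := (encMAcore P).2
      let b := (encMAcore Q).2
      (.res nL (.par (lockTrue nL) (.par (a nL) (b nL))), fun l => .par (a l) (b l))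

/-- The encoding `⟦·⟧ᵐₐ` from πₘ into πₐ. -/
def encMA (P : Proc) : Proc := (encMAcore P).1

/-- `⟦π.P⟧ᵐₐ` of a summand, with `l` as the sum lock of the surrounding sum. -/
def encMASummand (l : Name) (g : Proc) : Proc := (encMAcore g).2 l

/-! ## Target terms, requests and sum locks -/

/-- Target terms of `⟦·⟧ˢₐ`: encodings of πₛ terms and their derivatives. -/
def TargetSA (T : Proc) : Prop :=
  ∃ S : Proc, IsSep S ∧ (StructCong T (encSA S) ∨ Steps (encSA S) T)

/-- Target terms of `⟦·⟧ᵐₐ`: encodings of πₘ terms and their derivatives. -/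
def TargetMA (T : Proc) : Prop :=
  ∃ S : Proc, IsMix S ∧ (StructCong T (encMA S) ∨ Steps (encMA S) T)

/-- `T` contains an unguarded input request `p̄⟨y, l, r⟩` (an output with three
parameters), i.e. `T ≡ (νx̃)(T' ∣ p̄⟨y,l,r⟩)`. -/
def hasInputRequest (T : Proc) (p y l r : Name) : Prop :=
  ∃ (xs : List Name) (T' : Proc),
    StructCong T (resList xs (.par T' (.out p [y, l, r] .nil)))

/-- `T` contains an unguarded output request `p̄⟨y, l, s, z⟩` (an output with four
parameters), i.e. `T ≡ (νx̃)(T' ∣ p̄⟨y,l,s,z⟩)`. -/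
def hasOutputRequest (T : Proc) (p y l s z : Name) : Prop :=
  ∃ (xs : List Name) (T' : Proc),
    StructCong T (resList xs (.par T' (.out p [y, l, s, z] .nil)))

/-- `T` uses the name `l` as a link (subject of an input, output or replicated input)
with multiplicity `n`. -/
def usesLink : Proc → Name → ℕ → Prop
  | .nil, _, _ => False
  | .succ, _, _ => False
  | .res x P, l, n => l ≠ x ∧ usesLink P l n
  | .par P Q, l, n => usesLink P l n ∨ usesLink Q l n
  | .mat _ _ P, l, n => usesLink P l n
  | .inp y xs P, l, n => (y = l ∧ xs.length = n) ∨ (l ∉ xs ∧ usesLink P l n)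
  | .out y zs P, l, n => (y = l ∧ zs.length = n) ∨ usesLink P l n
  | .rep y xs P, l, n => (y = l ∧ xs.length = n) ∨ (l ∉ xs ∧ usesLink P l n)
  | .tau P, l, n => usesLink P l n
  | .choice P Q, l, n => usesLink P l n ∨ usesLink Q l n

/-- `T` contains an output on the link `l` carrying exactly the values `zs`. -/
def outputsOn : Proc → Name → List Name → Prop
  | .nil, _, _ => False
  | .succ, _, _ => False
  | .res x P, l, zs => l ≠ x ∧ outputsOn P l zs
  | .par P Q, l, zs => outputsOn P l zs ∨ outputsOn Q l zs
  | .mat _ _ P, l, zs => outputsOn P l zs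
  | .inp _ xs P, l, zs => l ∉ xs ∧ outputsOn P l zs
  | .out y zs' P, l, zs => (y = l ∧ zs' = zs) ∨ outputsOn P l zs
  | .rep _ xs P, l, zs => l ∉ xs ∧ outputsOn P l zs
  | .tau P, l, zs => outputsOn P l zs
  | .choice P Q, l, zs => outputsOn P l zs ∨ outputsOn Q l zs

/-- `l` is a sum lock of `T` (Definition 14): `l` is used in `T` as a link with
multiplicity two, carrying two links with multiplicity zero. -/
def IsSumLock (T : Proc) (l : Name) : Prop :=
  usesLink T l 2 ∧ (∀ n, usesLink T l n → n = 2) ∧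
  (∀ zs, outputsOn T l zs → ∀ z ∈ zs, ∀ n, usesLink T z n → n = 0)

/-! ## Translated observables (Definition 24) -/

/-- Observables/barbs: input or output on a (source-term) name. -/
inductive Barb : Type
  | inp : Name → Barb
  | out : Name → Barb

/-- Translated observables of `⟦·⟧ˢₐ`. -/
def transBarbSA : Proc → Barb → Prop
  | T, .inp y =>
      ∃ (xs : List Name) (T' T₁ T₂ : Proc) (l l' s z : Name),
        y ∉ xs ∧
        (StructCong T
            (resList xs (.par T' (.par (.inp y [l', s, z] (test l T₁ T₂)) (lockTrue l)))) ∨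
          ∃ B : Proc, StructCong T (resList xs (.par T' (.rep y [l', s, z] B))))
  | T, .out y =>
      ∃ (xs : List Name) (T' : Proc) (l s z : Name),
        y ∉ xs ∧
        StructCong T (resList xs (.par T' (.par (.out y [l, s, z] .nil) (lockTrue l))))

/-- Translated observables of `⟦·⟧ᵐₐ`. -/
def transBarbMA : Proc → Barb → Prop
  | T, .inp y =>
      ∃ (xs : List Name) (T' : Proc) (p l r : Name),
        y ∉ xs ∧
        StructCong T (resList xs (.par T' (.par (.out p [y, l, r] .nil) (lockTrue l))))
  | T, .out y =>
      ∃ (xs : List Name) (T' : Proc) (p l s z : Name),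
        y ∉ xs ∧
        StructCong T (resList xs (.par T' (.par (.out p [y, l, s, z] .nil) (lockTrue l))))

/-- weak (reachable) translated observables -/
def weakBarb (barb : Proc → Barb → Prop) (P : Proc) (μ : Barb) : Prop :=
  ∃ P', Steps P P' ∧ barb P' μ

/-! ## Translated barbed bisimilarity (Definitions 25 and 26) and congruence -/

/-- `R` is a translated barbed bisimulation with respect to the translated
observables `barb` (Definition 25). -/
def IsTransBisim (barb : Proc → Barb → Prop) (R : Proc → Proc → Prop) : Prop :=
  ∀ P Q, R P Q →
    (reachSuccess P ↔ reachSuccess Q) ∧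
    (∀ μ, weakBarb barb P μ ↔ weakBarb barb Q μ) ∧
    (∀ P', Reduces P P' → ∃ Q', Steps Q Q' ∧ R P' Q') ∧
    (∀ Q', Reduces Q Q' → ∃ P', Steps P P' ∧ R P' Q')

/-- `R` is a weak translated barbed bisimulation (Definition 26), not
distinguishing terms by reachable intermediate states. -/
def IsTransBisim2 (barb : Proc → Barb → Prop) (R : Proc → Proc → Prop) : Prop :=
  ∀ P Q, R P Q →
    (reachSuccess P ↔ reachSuccess Q) ∧
    (∀ μ, weakBarb barb P μ ↔ weakBarb barb Q μ) ∧
    (∀ P', Steps P P' → ∃ P'' Q'', Steps Q Q'' ∧ Steps P' P'' ∧ R P'' Q'') ∧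
    (∀ Q', Steps Q Q' → ∃ Q'' P'', Steps P P'' ∧ Steps Q' Q'' ∧ R P'' Q'')

/-- Translated barbed bisimilarity `≐ˢₐ` with respect to `⟦·⟧ˢₐ`. -/
def transBisimSA (P Q : Proc) : Prop := ∃ R, IsTransBisim transBarbSA R ∧ R P Q

/-- Translated barbed bisimilarity `≐ᵐₐ,₁` with respect to `⟦·⟧ᵐₐ`. -/
def transBisimMA1 (P Q : Proc) : Prop := ∃ R, IsTransBisim transBarbMA R ∧ R P Q

/-- Weak translated barbed bisimilarity `≐ᵐₐ,₂` with respect to `⟦·⟧ᵐₐ`. -/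
def transBisimMA2 (P Q : Proc) : Prop := ∃ R, IsTransBisim2 transBarbMA R ∧ R P Q

/-- Translated barbed congruence `≅ˢₐ` (Definition 28): closure of `≐ˢₐ` under all
πₐ-contexts that map target terms to target terms. -/
def transCongSA (T₁ T₂ : Proc) : Prop :=
  ∀ C : Proc → Proc, TargetSA (C (encSA .nil)) → transBisimSA (C T₁) (C T₂)

/-- Translated barbed congruence `≅ᵐₐ,₁`. -/
def transCongMA1 (T₁ T₂ : Proc) : Prop :=
  ∀ C : Proc → Proc, TargetMA (C (encMA .nil)) → transBisimMA1 (C T₁) (C T₂)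

/-- Weak translated barbed congruence `≅ᵐₐ,₂`. -/
def transCongMA2 (T₁ T₂ : Proc) : Prop :=
  ∀ C : Proc → Proc, TargetMA (C (encMA .nil)) → transBisimMA2 (C T₁) (C T₂)

/-! ## Pieces of target terms and junk (Definitions 31 and 32) -/

/-- Pieces of target terms of `⟦·⟧ˢₐ` (Definition 31). -/
inductive PieceSA : Proc → Prop
  | target {T : Proc} : TargetSA T → PieceSA T
  | drop {T T' J : Proc} {xs : List Name} :
      StructCong T (resList xs T') →
      transCongSA T (resList xs (.par T' J)) →
      PieceSA (resList xs (.par T' J)) → PieceSA T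

/-- Pieces of target terms of `⟦·⟧ᵐₐ` (Definition 31). -/
inductive PieceMA : Proc → Prop
  | target {T : Proc} : TargetMA T → PieceMA T
  | drop {T T' J : Proc} {xs : List Name} :
      StructCong T (resList xs T') →
      transCongMA1 T (resList xs (.par T' J)) →
      PieceMA (resList xs (.par T' J)) → PieceMA T

/-- `J` is junk of `⟦·⟧ˢₐ` modulo `≐ˢₐ` (Definition 32). -/
def JunkSA (J : Proc) : Prop :=
  ∀ C : Proc → Proc, PieceSA (C J) → transBisimSA (C J) (C .nil)

/-- `J` is junk of `⟦·⟧ᵐₐ` modulo `≐ᵐₐ` (Definition 32). -/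
def JunkMA (J : Proc) : Prop :=
  ∀ C : Proc → Proc, PieceMA (C J) → transBisimMA1 (C J) (C .nil)

/-! ## Pure administrative steps (Definition 23) -/

/-- A pure administrative step of `⟦·⟧ˢₐ`: a step that is neither on a sum lock
nor on a translated source term name. -/
def PureAdminStepSA (T₁ T₂ : Proc) : Prop :=
  ∃ a : Option Name, LabStep T₁ a T₂ ∧
    ∀ l : Name, a = some l → ¬ IsSumLock T₁ l ∧ (¬ ∃ n : Name, phiSA n = l)

/-- A sequence of pure administrative steps of `⟦·⟧ˢₐ`. -/
def PureAdminStepsSA : Proc → Proc → Prop := Relation.ReflTransGen PureAdminStepSA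

/-! ## Gorla's quality criteria (Definitions 5–11) -/

/-- Criterion 1 (compositionality): every operator is translated by a fixed context,
parametrisable on the free names of its parameters, applied to the translations
of its parameters. -/
def Compositional (enc : Proc → Proc) (lang : Proc → Prop) : Prop :=
  (∃ C : Name → Finset Name → Proc → Proc,
    ∀ (x : Name) (S : Proc), lang (.res x S) → enc (.res x S) = C x (freeNames S) (enc S)) ∧
  (∃ C : Finset Name → Proc → Proc → Proc,
    ∀ S₁ S₂ : Proc, lang (.par S₁ S₂) →
      enc (.par S₁ S₂) = C (freeNames S₁ ∪ freeNames S₂) (enc S₁) (enc S₂)) ∧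
  (∃ C : Name → Name → Finset Name → Proc → Proc,
    ∀ (a b : Name) (S : Proc), lang (.mat a b S) →
      enc (.mat a b S) = C a b (freeNames S) (enc S)) ∧
  (∃ C : Name → List Name → Finset Name → Proc → Proc,
    ∀ (y : Name) (xs : List Name) (S : Proc), lang (.inp y xs S) →
      enc (.inp y xs S) = C y xs (freeNames S) (enc S)) ∧
  (∃ C : Name → List Name → Finset Name → Proc → Proc,
    ∀ (y : Name) (zs : List Name) (S : Proc), lang (.out y zs S) →
      enc (.out y zs S) = C y zs (freeNames S) (enc S)) ∧
  (∃ C : Name → List Name → Finset Name → Proc → Proc,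
    ∀ (y : Name) (xs : List Name) (S : Proc), lang (.rep y xs S) →
      enc (.rep y xs S) = C y xs (freeNames S) (enc S)) ∧
  (∃ C : Finset Name → Proc → Proc,
    ∀ S : Proc, lang (.tau S) → enc (.tau S) = C (freeNames S) (enc S)) ∧
  (∃ C : Finset Name → Proc → Proc → Proc,
    ∀ S₁ S₂ : Proc, lang (.choice S₁ S₂) →
      enc (.choice S₁ S₂) = C (freeNames S₁ ∪ freeNames S₂) (enc S₁) (enc S₂))

/-- Criterion 2 (name invariance) with respect to the renaming policy `φ` and the
equivalence `eqv` on the target. -/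
def NameInvariant (enc : Proc → Proc) (lang : Proc → Prop) (φ : Name → Name)
    (eqv : Proc → Proc → Prop) : Prop :=
  ∀ (S : Proc) (σ : Name → Name), lang S → ∃ σ' : Name → Name,
    (∀ n : Name, φ (σ n) = σ' (φ n)) ∧
    (Function.Injective σ → AlphaEq (enc (applySubst σ S)) (applySubst σ' (enc S))) ∧
    (¬ Function.Injective σ → eqv (enc (applySubst σ S)) (applySubst σ' (enc S)))

/-- operational completeness (half of Criterion 3) -/
def OperationallyComplete (enc : Proc → Proc) (lang : Proc → Prop)
    (eqv : Proc → Proc → Prop) : Prop :=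
  ∀ S S' : Proc, lang S → Steps S S' → ∃ T : Proc, Steps (enc S) T ∧ eqv T (enc S')

/-- operational soundness (half of Criterion 3) -/
def OperationallySound (enc : Proc → Proc) (lang : Proc → Prop)
    (eqv : Proc → Proc → Prop) : Prop :=
  ∀ S T : Proc, lang S → Steps (enc S) T →
    ∃ S' T' : Proc, Steps S S' ∧ Steps T T' ∧ eqv T' (enc S')

/-- Criterion 4 (divergence reflection) -/
def DivergenceReflecting (enc : Proc → Proc) (lang : Proc → Prop) : Prop :=
  ∀ S : Proc, lang S → Divergent (enc S) → Divergent S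

/-- Criterion 5 (success sensitiveness) -/
def SuccessSensitive (enc : Proc → Proc) (lang : Proc → Prop) : Prop :=
  ∀ S : Proc, lang S → (reachSuccess S ↔ reachSuccess (enc S))

/-- The equivalence `eqv` is success respecting (Definition 11). -/
def SuccessRespecting (eqv : Proc → Proc → Prop) : Prop :=
  ∀ P Q : Proc, reachSuccess P → ¬ reachSuccess Q → ¬ eqv P Q

/-- A good encoding in the sense of Gorla: it satisfies the five criteria
with respect to the behavioural equivalence `eqv` on the target language. -/
def GoodEncoding (enc : Proc → Proc) (lang : Proc → Prop) (φ : Name → Name)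
    (eqv : Proc → Proc → Prop) : Prop :=
  Compositional enc lang ∧
  NameInvariant enc lang φ eqv ∧
  OperationallyComplete enc lang eqv ∧
  OperationallySound enc lang eqv ∧
  DivergenceReflecting enc lang ∧
  SuccessSensitive enc lang

/-! ## Preservation of the degree of distribution (Definition 5 of [PN12]) -/

/-- `enc` preserves the degree of distribution: for every source term
`S ≡ᵣₑₚ S₁ ∣ … ∣ Sₙ` with `Sᵢ ⟹ Sᵢ'` there are target terms `T₁, …, Tₙ` and an
`n`-ary context `C` such that `enc S ≡ᵣₑₚ C[T₁, …, Tₙ]` and `Tᵢ ⟹ ≍ enc Sᵢ'`. -/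
def PreservesDistribution (enc : Proc → Proc) (lang : Proc → Prop)
    (eqv : Proc → Proc → Prop) : Prop :=
  ∀ (S : Proc) (SL SL' : List Proc), lang S →
    StructCongRep S (parList SL) →
    List.Forall₂ Steps SL SL' →
    ∃ (TL : List Proc) (C : List Proc → Proc),
      TL.length = SL.length ∧
      StructCongRep (enc S) (C TL) ∧
      List.Forall₂ (fun T S' => ∃ T', Steps T T' ∧ eqv T' (enc S')) TL SL'


/-! ## De Bruijn normal forms relative to a valuation of names -/

def DBName.shift : DBName → DBName
  | .free x => .free x
  | .bound i => .bound (i + 1)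

/-- Extends the valuation `ρ` to the scope of a binder for `x`. -/
def bindName (ρ : Name → DBName) (x : Name) : Name → DBName :=
  fun z => if z = x then .bound 0 else (ρ z).shift

def bindNames : (Name → DBName) → List Name → Name → DBName
  | ρ, [] => ρ
  | ρ, x :: xs => bindNames (bindName ρ x) xs

/-- The de Bruijn form of a process whose free names are interpreted by a valuation. -/
def evalDB : (Name → DBName) → Proc → DB
  | _, .nil => .nil
  | _, .succ => .succ
  | ρ, .res x P => .res (evalDB (bindName ρ x) P)
  | ρ, .par P Q => .par (evalDB ρ P) (evalDB ρ Q)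
  | ρ, .mat a b P => .mat (ρ a) (ρ b) (evalDB ρ P)
  | ρ, .inp y xs P => .inp (ρ y) xs.length (evalDB (bindNames ρ xs) P)
  | ρ, .out y zs P => .out (ρ y) (zs.map ρ) (evalDB ρ P)
  | ρ, .rep y xs P => .rep (ρ y) xs.length (evalDB (bindNames ρ xs) P)
  | ρ, .tau P => .tau (evalDB ρ P)
  | ρ, .choice P Q => .choice (evalDB ρ P) (evalDB ρ Q)

theorem dbVar_nil : dbVar [] = DBName.free := rfl

theorem dbVar_cons (x : Name) (env : List Name) :
    dbVar (x :: env) = bindName (dbVar env) x := by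
  funext z
  by_cases h : z = x
  · subst h
    simp [dbVar, bindName, List.findIdx?_cons]
  · have h' : ¬ x = z := fun e => h e.symm
    simp only [dbVar, bindName, List.findIdx?_cons, beq_iff_eq, h, h', if_false]
    cases List.findIdx? (fun w => w == z) env <;> rfl

theorem dbVar_reverse_append (xs env : List Name) :
    dbVar (xs.reverse ++ env) = bindNames (dbVar env) xs := by
  induction xs generalizing env with
  | nil => rfl
  | cons x xs ih => simp [bindNames, ← dbVar_cons, ih]

theorem toDB_eq_evalDB (env : List Name) (P : Proc) :
    toDB env P = evalDB (dbVar env) P := by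
  induction P generalizing env <;>
    simp_all [toDB, evalDB, dbVar_cons, dbVar_reverse_append]

theorem bindNames_of_notMem {xs : List Name} {z : Name} (hz : z ∉ xs) (ρ : Name → DBName) :
    bindNames ρ xs z = DBName.shift^[xs.length] (ρ z) := by
  induction xs generalizing ρ with
  | nil => rfl
  | cons x xs ih =>
    simp only [List.mem_cons, not_or] at hz
    simp [bindNames, ih hz.2, bindName, hz.1]

theorem bindNames_congr {ρ ρ' : Name → DBName} {z z' : Name} (xs : List Name)
    (h : z = z') (hρ : ρ z = ρ' z') : bindNames ρ xs z = bindNames ρ' xs z' := by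
  subst h
  induction xs generalizing ρ ρ' with
  | nil => exact hρ
  | cons x xs ih => exact ih (by simp [bindName, hρ])

theorem bindNames_append (ρ : Name → DBName) (xs ys : List Name) :
    bindNames ρ (xs ++ ys) = bindNames (bindNames ρ xs) ys := by
  induction xs generalizing ρ with
  | nil => rfl
  | cons x xs ih => exact ih _

/-! ## Fresh names and substitution -/

theorem freshName_notMem (avoid : Finset Name) : freshName avoid ∉ avoid := by
  intro h
  exact Nat.not_succ_le_self _ (Finset.le_sup (f := id) h)

theorem length_freshNames (avoid : Finset Name) (n : ℕ) : (freshNames avoid n).length = n := by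
  induction n generalizing avoid with
  | zero => rfl
  | succ n ih => simp [freshNames, ih]

theorem notMem_freshNames {avoid : Finset Name} {z : Name} (hz : z ∈ avoid) (n : ℕ) :
    z ∉ freshNames avoid n := by
  induction n generalizing avoid with
  | zero => simp [freshNames]
  | succ n ih =>
    simp only [freshNames, List.mem_cons, not_or]
    refine ⟨?_, ih (Finset.mem_insert_of_mem hz)⟩
    rintro rfl
    exact freshName_notMem _ hz

theorem nodup_freshNames (avoid : Finset Name) (n : ℕ) : (freshNames avoid n).Nodup := by
  induction n generalizing avoid with
  | zero => exact List.nodup_nil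
  | succ n ih =>
    exact List.nodup_cons.2 ⟨notMem_freshNames (Finset.mem_insert_self _ _) n, ih _⟩

theorem updates_mem_or {xs ys : List Name} (hlen : xs.length = ys.length)
    (σ : Name → Name) (z : Name) :
    updates σ xs ys z ∈ ys ∨ (z ∉ xs ∧ updates σ xs ys z = σ z) := by
  induction xs generalizing ys with
  | nil => exact .inr ⟨List.not_mem_nil, rfl⟩
  | cons x xs ih =>
    cases ys with
    | nil => simp at hlen
    | cons y ys =>
      by_cases hz : z = x
      · subst hz
        simp [updates]
      · have := ih (ys := ys) (by simpa using hlen)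
        simp only [updates, Function.update_of_ne hz, List.mem_cons, hz, false_or]
        tauto

theorem bindNames_updates {xs ys : List Name} (hlen : xs.length = ys.length) (hys : ys.Nodup)
    {σ : Name → Name} {ρ ρ' : Name → DBName} {z : Name} (hcount : xs.count z ≤ 1)
    (hz : z ∉ xs → σ z ∉ ys ∧ ρ (σ z) = ρ' z) :
    bindNames ρ ys (updates σ xs ys z) = bindNames ρ' xs z := by
  induction xs generalizing ys ρ ρ' with
  | nil =>
    cases ys with
    | nil => exact (hz List.not_mem_nil).2
    | cons y ys => simp at hlen
  | cons x xs ih =>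
    cases ys with
    | nil => simp at hlen
    | cons y ys =>
      have hlen' : xs.length = ys.length := by simpa using hlen
      obtain ⟨hy, hys'⟩ := List.nodup_cons.1 hys
      by_cases hx : z = x
      · subst hx
        have hzxs : z ∉ xs := by
          rw [List.count_cons_self] at hcount
          exact List.count_eq_zero.1 (by omega)
        simp [updates, bindNames, bindNames_of_notMem hzxs, bindNames_of_notMem hy, bindName,
          hlen']
      · simp only [updates, Function.update_of_ne hx, bindNames]
        refine ih hlen' hys' ?_ ?_
        · rwa [List.count_cons_of_ne (Ne.symm hx)] at hcount
        · intro hzxs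
          obtain ⟨h1, h2⟩ := hz (by simp [hx, hzxs])
          simp only [List.mem_cons, not_or] at h1
          exact ⟨h1.2, by simp [bindName, h1.1, hx, h2]⟩

/-- No input binds a name repeatedly that is used in its continuation. -/
def UnambiguousBinders : Proc → Prop
  | .nil => True
  | .succ => True
  | .res _ P => UnambiguousBinders P
  | .par P Q => UnambiguousBinders P ∧ UnambiguousBinders Q
  | .mat _ _ P => UnambiguousBinders P
  | .inp _ xs P => (∀ z ∈ freeNames P, xs.count z ≤ 1) ∧ UnambiguousBinders P
  | .out _ _ P => UnambiguousBinders P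
  | .rep _ xs P => (∀ z ∈ freeNames P, xs.count z ≤ 1) ∧ UnambiguousBinders P
  | .tau P => UnambiguousBinders P
  | .choice P Q => UnambiguousBinders P ∧ UnambiguousBinders Q

theorem evalDB_freshen_input {P : Proc} {xs : List Name} {σ : Name → Name}
    {avoid : Finset Name} {ρ ρ' : Name → DBName}
    (ih : ∀ (σ : Name → Name) (avoid : Finset Name) (ρ ρ' : Name → DBName),
      (∀ z ∈ freeNames P, σ z ∈ avoid) → (∀ z ∈ freeNames P, ρ (σ z) = ρ' z) →
      evalDB ρ (applySubstAux σ avoid P) = evalDB ρ' P)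
    (hxs : ∀ z ∈ freeNames P, xs.count z ≤ 1)
    (hσ : ∀ z ∈ freeNames P, z ∉ xs → σ z ∈ avoid)
    (hρ : ∀ z ∈ freeNames P, z ∉ xs → ρ (σ z) = ρ' z) :
    evalDB (bindNames ρ (freshNames avoid xs.length))
      (applySubstAux (updates σ xs (freshNames avoid xs.length))
        (avoid ∪ (freshNames avoid xs.length).toFinset) P) =
    evalDB (bindNames ρ' xs) P := by
  have hlen := (length_freshNames avoid xs.length).symm
  refine ih _ _ _ _ (fun z hz => ?_) (fun z hz => ?_)
  · rcases updates_mem_or hlen σ z with h | ⟨h, he⟩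
    · simp [h]
    · simp [he, hσ z hz h]
  · exact bindNames_updates hlen (nodup_freshNames _ _) (hxs z hz)
      fun h => ⟨notMem_freshNames (hσ z hz h) _, hρ z hz h⟩

theorem evalDB_applySubstAux {P : Proc} (hP : UnambiguousBinders P) (σ : Name → Name)
    (avoid : Finset Name) (ρ ρ' : Name → DBName)
    (hσ : ∀ z ∈ freeNames P, σ z ∈ avoid) (hρ : ∀ z ∈ freeNames P, ρ (σ z) = ρ' z) :
    evalDB ρ (applySubstAux σ avoid P) = evalDB ρ' P := by
  induction P generalizing σ avoid ρ ρ' with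
  | nil => rfl
  | succ => rfl
  | res x P ih =>
    simp only [applySubstAux, evalDB]
    simp only [freeNames, Finset.mem_sdiff, Finset.mem_singleton] at hσ hρ
    congr 1
    refine ih hP _ _ _ _ (fun z hz => ?_) (fun z hz => ?_)
    · by_cases h : z = x
      · simp [h]
      · simp [h, hσ z ⟨hz, h⟩]
    · by_cases h : z = x
      · simp [h, bindName]
      · have : σ z ≠ freshName avoid := fun e => freshName_notMem avoid (e ▸ hσ z ⟨hz, h⟩)
        simp [h, bindName, this, hρ z ⟨hz, h⟩]
  | par P Q ihP ihQ =>
    simp only [freeNames, Finset.mem_union] at hσ hρ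
    simp only [applySubstAux, evalDB]
    rw [ihP hP.1 _ _ _ _ (fun z h => hσ z (.inl h)) (fun z h => hρ z (.inl h)),
      ihQ hP.2 _ _ _ _ (fun z h => hσ z (.inr h)) (fun z h => hρ z (.inr h))]
  | choice P Q ihP ihQ =>
    simp only [freeNames, Finset.mem_union] at hσ hρ
    simp only [applySubstAux, evalDB]
    rw [ihP hP.1 _ _ _ _ (fun z h => hσ z (.inl h)) (fun z h => hρ z (.inl h)),
      ihQ hP.2 _ _ _ _ (fun z h => hσ z (.inr h)) (fun z h => hρ z (.inr h))]
  | mat a b P ih =>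
    simp only [freeNames, Finset.mem_insert] at hσ hρ
    simp only [applySubstAux, evalDB]
    rw [ih hP _ _ _ _ (fun z h => hσ z (.inr (.inr h))) (fun z h => hρ z (.inr (.inr h))),
      hρ a (.inl rfl), hρ b (.inr (.inl rfl))]
  | tau P ih =>
    simp only [applySubstAux, evalDB]
    rw [ih hP _ _ _ _ hσ hρ]
  | out y zs P ih =>
    simp only [freeNames, Finset.mem_insert, Finset.mem_union, List.mem_toFinset] at hσ hρ
    simp only [applySubstAux, evalDB]
    rw [ih hP _ _ _ _ (fun z h => hσ z (.inr (.inr h))) (fun z h => hρ z (.inr (.inr h))),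
      hρ y (.inl rfl), List.map_map,
      List.map_congr_left (f := ρ ∘ σ) fun z h => hρ z (.inr (.inl h))]
  | inp y xs P ih =>
    simp only [freeNames, Finset.mem_insert, Finset.mem_sdiff, List.mem_toFinset] at hσ hρ
    simp only [applySubstAux, evalDB, length_freshNames]
    rw [hρ y (.inl rfl), evalDB_freshen_input (ih hP.2) hP.1
      (fun z h h' => hσ z (.inr ⟨h, h'⟩)) (fun z h h' => hρ z (.inr ⟨h, h'⟩))]
  | rep y xs P ih =>
    simp only [freeNames, Finset.mem_insert, Finset.mem_sdiff, List.mem_toFinset] at hσ hρ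
    simp only [applySubstAux, evalDB, length_freshNames]
    rw [hρ y (.inl rfl), evalDB_freshen_input (ih hP.2) hP.1
      (fun z h h' => hσ z (.inr ⟨h, h'⟩)) (fun z h h' => hρ z (.inr ⟨h, h'⟩))]

theorem freeNames_subset_allNames (P : Proc) : freeNames P ⊆ allNames P := by
  induction P <;> intro z hz <;>
    simp_all only [freeNames, allNames, Finset.subset_iff, Finset.mem_union, Finset.mem_insert,
      Finset.mem_sdiff, Finset.mem_singleton] <;> tauto

theorem evalDB_applySubst {P : Proc} (hP : UnambiguousBinders P) (σ : Name → Name)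
    (ρ : Name → DBName) : evalDB ρ (applySubst σ P) = evalDB (ρ ∘ σ) P :=
  evalDB_applySubstAux hP _ _ _ _
    (fun _ hz => Finset.mem_union_right _
      (Finset.mem_image_of_mem _ (freeNames_subset_allNames P hz)))
    (fun _ _ => rfl)

/-! ## The encoding binds names unambiguously -/

/-- All inputs bind exactly one name. -/
def MonadicInputs : Proc → Prop
  | .nil => True
  | .succ => True
  | .res _ P => MonadicInputs P
  | .par P Q => MonadicInputs P ∧ MonadicInputs Q
  | .mat _ _ P => MonadicInputs P
  | .inp _ xs P => (∃ x, xs = [x]) ∧ MonadicInputs P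
  | .out _ _ P => MonadicInputs P
  | .rep _ xs P => (∃ x, xs = [x]) ∧ MonadicInputs P
  | .tau P => MonadicInputs P
  | .choice P Q => MonadicInputs P ∧ MonadicInputs Q

theorem IsMix.monadicInputs {P : Proc} (h : IsMix P) : MonadicInputs P := by
  induction h using IsMix.rec (motive_2 := fun P _ => MonadicInputs P) <;>
    simp_all [MonadicInputs]

theorem unambiguousBinders_inp {xs : List Name} (h : xs.Nodup) (y : Name) (P : Proc) :
    UnambiguousBinders (.inp y xs P) ↔ UnambiguousBinders P :=
  and_iff_right fun z _ => List.nodup_iff_count_le_one.1 h z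

theorem unambiguousBinders_rep {xs : List Name} (h : xs.Nodup) (y : Name) (P : Proc) :
    UnambiguousBinders (.rep y xs P) ↔ UnambiguousBinders P :=
  and_iff_right fun z _ => List.nodup_iff_count_le_one.1 h z

theorem ne_phiMA_of_lt {m : Name} (h : m < 50) (n : Name) : m ≠ phiMA n :=
  fun e => Nat.not_lt.2 (Nat.le_add_left 50 n) (show phiMA n < 50 from e ▸ h)

theorem phiMA_notMem {rs : List Name} (h : ∀ r ∈ rs, r < 50) (x : Name) : phiMA x ∉ rs :=
  fun hx => ne_phiMA_of_lt (h _ hx) x rfl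

theorem nodup_append_phiMA {rs : List Name} (h : ∀ r ∈ rs, r < 50) (hrs : rs.Nodup) (x : Name) :
    (rs ++ [phiMA x]).Nodup := by
  rw [List.nodup_append_comm]
  exact List.nodup_cons.2 ⟨phiMA_notMem h x, hrs⟩

theorem unambiguousBinders_lockTrue (l : Name) : UnambiguousBinders (lockTrue l) :=
  (unambiguousBinders_inp (by decide) _ _).2 trivial

theorem unambiguousBinders_lockFalse (l : Name) : UnambiguousBinders (lockFalse l) :=
  (unambiguousBinders_inp (by decide) _ _).2 trivial

theorem unambiguousBinders_test {P Q : Proc} (l : Name) (hP : UnambiguousBinders P)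
    (hQ : UnambiguousBinders Q) : UnambiguousBinders (test l P Q) :=
  ⟨trivial, (unambiguousBinders_inp List.nodup_nil _ _).2 hP,
    (unambiguousBinders_inp List.nodup_nil _ _).2 hQ⟩

theorem unambiguousBinders_forward (y : Name) (ys : List Name) (n : ℕ) :
    UnambiguousBinders (forward y ys n) := by
  refine (unambiguousBinders_rep ?_ _ _).2 ?_
  · exact List.nodup_range.map fun a b h => Nat.add_left_cancel h
  · induction ys with
    | nil => trivial
    | cons y ys ih =>
      cases ys with
      | nil => trivial
      | cons y' ys => exact ⟨trivial, ih⟩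

theorem unambiguousBinders_procRightOut : UnambiguousBinders procRightOut := by
  refine ⟨trivial, (unambiguousBinders_rep (by decide) _ _).2 <|
    (unambiguousBinders_inp (by decide) _ _).2 ⟨⟨?_, ?_⟩, trivial⟩⟩
  · exact (unambiguousBinders_rep (by decide) _ _).2 ⟨trivial, trivial⟩
  · exact ⟨unambiguousBinders_forward _ _ _, trivial⟩

theorem unambiguousBinders_procRightIn : UnambiguousBinders procRightIn := by
  refine ⟨trivial, (unambiguousBinders_rep (by decide) _ _).2 <|
    (unambiguousBinders_inp (by decide) _ _).2 ⟨⟨?_, ?_⟩, trivial⟩⟩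
  · exact (unambiguousBinders_rep (by decide) _ _).2 ⟨trivial, trivial⟩
  · exact ⟨unambiguousBinders_forward _ _ _, trivial⟩

theorem unambiguousBinders_encMApar {P Q : Proc} (hP : UnambiguousBinders P)
    (hQ : UnambiguousBinders Q) : UnambiguousBinders (encMApar P Q) := by
  simp [encMApar, resList, parList, UnambiguousBinders, procLeftOut, procLeftIn, pushReqs,
    unambiguousBinders_forward, unambiguousBinders_procRightOut, unambiguousBinders_procRightIn,
    hP, hQ]

theorem unambiguousBinders_encMAbranch {P : Proc} (hP : UnambiguousBinders P) :
    UnambiguousBinders (encMAbranch P) := by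
  simp [encMAbranch, resList, parList, UnambiguousBinders, pushReqsIn, pushReqsOut,
    unambiguousBinders_forward, unambiguousBinders_procRightOut, unambiguousBinders_procRightIn,
    hP]

theorem unambiguousBinders_encMArep {P : Proc} (hP : UnambiguousBinders P) (y x : Name) :
    UnambiguousBinders (encMArep y [phiMA x] P) := by
  simp only [encMArep, resList, parList]
  refine ⟨trivial, ⟨fun z hz => ?_, ?_⟩, trivial, unambiguousBinders_lockTrue _, trivial, ?_⟩
  · have hz' : z ≠ nDash := by
      rintro rfl
      simp [test, lockFalse, freeNames, nDash, nLs, nS, nT, nF, nCr1, phiMA] at hz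
    have hnodup : ([nLs, nS] ++ [phiMA x]).Nodup :=
      nodup_append_phiMA (by decide) (by decide) x
    have hcount := List.nodup_iff_count_le_one.1 hnodup z
    simpa [List.count_cons_of_ne hz'.symm] using hcount
  · exact unambiguousBinders_test _
      ⟨unambiguousBinders_lockFalse _, trivial, trivial⟩ (unambiguousBinders_lockFalse _)
  · exact (unambiguousBinders_rep (List.nodup_singleton _) _ _).2 <|
      (unambiguousBinders_inp (by decide) _ _).2 (unambiguousBinders_encMAbranch hP)

theorem unambiguousBinders_encMAcore {S : Proc} (hS : MonadicInputs S) :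
    UnambiguousBinders (encMAcore S).1 ∧ ∀ l, UnambiguousBinders ((encMAcore S).2 l) := by
  induction S with
  | nil => exact ⟨⟨unambiguousBinders_lockTrue _, trivial⟩, fun _ => trivial⟩
  | succ => exact ⟨trivial, fun _ => trivial⟩
  | res x P ih => exact ⟨(ih hS).1, fun _ => trivial⟩
  | par P Q ihP ihQ =>
    exact ⟨unambiguousBinders_encMApar (ihP hS.1).1 (ihQ hS.2).1, fun _ => trivial⟩
  | mat a b P ih => exact ⟨(ih hS).1, fun _ => trivial⟩
  | rep y xs P ih =>
    obtain ⟨⟨x, rfl⟩, hP⟩ := hS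
    exact ⟨unambiguousBinders_encMArep (ih hP).1 _ _, fun _ => trivial⟩
  | tau P ih =>
    have h (l : Name) : UnambiguousBinders ((encMAcore (.tau P)).2 l) :=
      unambiguousBinders_test _ ⟨unambiguousBinders_lockFalse _, (ih hS).1⟩
        (unambiguousBinders_lockFalse _)
    exact ⟨⟨unambiguousBinders_lockTrue _, h nL⟩, h⟩
  | out y zs P ih =>
    have h (l : Name) : UnambiguousBinders ((encMAcore (.out y zs P)).2 l) :=
      ⟨trivial, (unambiguousBinders_inp List.nodup_nil _ _).2 (ih hS).1⟩
    exact ⟨⟨unambiguousBinders_lockTrue _, h nL⟩, h⟩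
  | inp y xs P ih =>
    obtain ⟨⟨x, rfl⟩, hP⟩ := hS
    have h (l : Name) : UnambiguousBinders ((encMAcore (.inp y [x] P)).2 l) := by
      refine ⟨trivial, (unambiguousBinders_rep
        (nodup_append_phiMA (by decide) (by decide) x) _ _).2 ?_⟩
      exact unambiguousBinders_test _
        (unambiguousBinders_test _
          ⟨unambiguousBinders_lockFalse _, unambiguousBinders_lockFalse _, trivial, (ih hP).1⟩
          ⟨unambiguousBinders_lockTrue _, unambiguousBinders_lockFalse _⟩)
        (unambiguousBinders_lockFalse _)
    exact ⟨⟨unambiguousBinders_lockTrue _, h nL⟩, h⟩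
  | choice P Q ihP ihQ =>
    have h (l : Name) : UnambiguousBinders ((encMAcore (.choice P Q)).2 l) :=
      ⟨(ihP hS.1).2 l, (ihQ hS.2).2 l⟩
    exact ⟨⟨unambiguousBinders_lockTrue _, h nL⟩, h⟩

/-! ## Target terms related by a renaming of source names -/

/-- The target name `a` arises from `b` by applying `σ` to translated names in `F` and
keeping reserved names. -/
def RenamesTo (σ : Name → Name) (F : Finset Name) (a b : Name) : Prop :=
  (a < 50 ∧ a = b) ∨ ∃ n ∈ F, a = phiMA (σ n) ∧ b = phiMA n

/-- The processes have the same de Bruijn form under valuations agreeing along `RenamesTo`. -/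
def RelatedBy (σ : Name → Name) (F : Finset Name) (P Q : Proc) : Prop :=
  ∀ ρ ρ' : Name → DBName, (∀ a b, RenamesTo σ F a b → ρ a = ρ' b) → evalDB ρ P = evalDB ρ' Q

theorem RenamesTo.reserved {σ : Name → Name} {F : Finset Name} {m : Name} (h : m < 50) :
    RenamesTo σ F m m := .inl ⟨h, rfl⟩

theorem RenamesTo.phiMA {σ : Name → Name} {F : Finset Name} {n : Name} (h : n ∈ F) :
    RenamesTo σ F (phiMA (σ n)) (phiMA n) := .inr ⟨n, h, rfl, rfl⟩

theorem RenamesTo.eq_iff {σ : Name → Name} {F : Finset Name} {a b m : Name} (hm : m < 50)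
    (h : RenamesTo σ F a b) : a = m ↔ b = m := by
  rcases h with ⟨_, rfl⟩ | ⟨n, _, rfl, rfl⟩
  · rfl
  · exact iff_of_false (ne_phiMA_of_lt hm _).symm (ne_phiMA_of_lt hm _).symm

theorem RenamesTo.bindNames_eq {σ : Name → Name} {F : Finset Name} {rs : List Name}
    (hrs : ∀ r ∈ rs, r < 50) {ρ ρ' : Name → DBName}
    (hρ : ∀ a b, RenamesTo σ F a b → ρ a = ρ' b) {a b : Name} (h : RenamesTo σ F a b) :
    bindNames ρ rs a = bindNames ρ' rs b := by
  induction rs generalizing ρ ρ' with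
  | nil => exact hρ a b h
  | cons r rs ih =>
    refine ih (fun r' hr' => hrs r' (List.mem_cons_of_mem _ hr')) fun c d hcd => ?_
    simp [bindName, hcd.eq_iff (hrs r List.mem_cons_self), hρ c d hcd]

theorem RenamesTo.bindName_phiMA_eq {σ : Name → Name} {F : Finset Name} {x x' : Name}
    (hx' : ∀ n ∈ F, σ n ≠ x') {ρ ρ' : Name → DBName}
    (hρ : ∀ a b, RenamesTo σ F a b → ρ a = ρ' b) {a b : Name}
    (h : RenamesTo (Function.update σ x x') (insert x F) a b) :
    bindName ρ (PiCalc.phiMA x') a = bindName ρ' (PiCalc.phiMA x) b := by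
  have hinj (m n : Name) : PiCalc.phiMA m = PiCalc.phiMA n ↔ m = n := Nat.add_right_cancel_iff
  rcases h with ⟨ha, rfl⟩ | ⟨n, hn, rfl, rfl⟩
  · simp [bindName, ne_phiMA_of_lt ha, hρ a a (.reserved ha)]
  · by_cases hnx : n = x
    · simp [hnx, bindName]
    · have hnF : n ∈ F := (Finset.mem_insert.1 hn).resolve_left hnx
      simp [bindName, hinj, hnx, hx' n hnF, hρ _ _ (.phiMA hnF)]

namespace RelatedBy

variable {σ : Name → Name} {F : Finset Name} {P P' Q Q' : Proc}

theorem par (hP : RelatedBy σ F P P') (hQ : RelatedBy σ F Q Q') :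
    RelatedBy σ F (.par P Q) (.par P' Q') := fun ρ ρ' h => by
  simp only [evalDB, hP ρ ρ' h, hQ ρ ρ' h]

theorem mat {a b a' b' : Name} (ha : RenamesTo σ F a a') (hb : RenamesTo σ F b b')
    (hP : RelatedBy σ F P P') : RelatedBy σ F (.mat a b P) (.mat a' b' P') := fun ρ ρ' h => by
  simp only [evalDB, hP ρ ρ' h, h _ _ ha, h _ _ hb]

theorem out {y y' : Name} {zs zs' : List Name} (hy : RenamesTo σ F y y')
    (hzs : List.Forall₂ (RenamesTo σ F) zs zs') (hP : RelatedBy σ F P P') :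
    RelatedBy σ F (.out y zs P) (.out y' zs' P') := fun ρ ρ' h => by
  have hmap : zs.map ρ = zs'.map ρ' := by
    induction hzs with
    | nil => rfl
    | cons hz _ ih => simp only [List.map_cons, h _ _ hz, ih]
  simp only [evalDB, hP ρ ρ' h, h _ _ hy, hmap]

theorem res {x : Name} (hx : x < 50) (hP : RelatedBy σ F P P') :
    RelatedBy σ F (.res x P) (.res x P') := fun ρ ρ' h => by
  exact congrArg DB.res <|
    hP _ _ fun a b hab => RenamesTo.bindNames_eq (rs := [x]) (by simpa using hx) h hab

theorem resList {xs : List Name} (hxs : ∀ x ∈ xs, x < 50) (hP : RelatedBy σ F P P') :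
    RelatedBy σ F (resList xs P) (resList xs P') := by
  induction xs with
  | nil => exact hP
  | cons x xs ih =>
    exact res (hxs x List.mem_cons_self) (ih fun y hy => hxs y (List.mem_cons_of_mem _ hy))

theorem inp {y y' : Name} {xs : List Name} (hy : RenamesTo σ F y y') (hxs : ∀ x ∈ xs, x < 50)
    (hP : RelatedBy σ F P P') : RelatedBy σ F (.inp y xs P) (.inp y' xs P') := fun ρ ρ' h => by
  simp only [evalDB]
  rw [hP _ _ fun a b hab => RenamesTo.bindNames_eq hxs h hab, h _ _ hy]

theorem rep {y y' : Name} {xs : List Name} (hy : RenamesTo σ F y y') (hxs : ∀ x ∈ xs, x < 50)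
    (hP : RelatedBy σ F P P') : RelatedBy σ F (.rep y xs P) (.rep y' xs P') := fun ρ ρ' h => by
  simp only [evalDB]
  rw [hP _ _ fun a b hab => RenamesTo.bindNames_eq hxs h hab, h _ _ hy]

theorem res_phiMA {x x' : Name} (hx' : ∀ n ∈ F, σ n ≠ x')
    (hP : RelatedBy (Function.update σ x x') (insert x F) P P') :
    RelatedBy σ F (.res (phiMA x') P) (.res (phiMA x) P') := fun ρ ρ' h => by
  simp only [evalDB]
  rw [hP _ _ fun a b hab => RenamesTo.bindName_phiMA_eq hx' h hab]

theorem rep_phiMA {x x' y y' : Name} {rs : List Name} (hy : RenamesTo σ F y y')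
    (hrs : ∀ r ∈ rs, r < 50) (hx' : ∀ n ∈ F, σ n ≠ x')
    (hP : RelatedBy (Function.update σ x x') (insert x F) P P') :
    RelatedBy σ F (.rep y (rs ++ [phiMA x']) P) (.rep y' (rs ++ [phiMA x]) P') :=
  fun ρ ρ' h => by
    simp only [evalDB, bindNames_append, bindNames, List.length_append, List.length_singleton]
    rw [hP _ _ fun a b hab => RenamesTo.bindName_phiMA_eq hx'
      (fun c d hcd => RenamesTo.bindNames_eq hrs h hcd) hab, h _ _ hy]

theorem of_reserved (h : ∀ m ∈ allNames P, m < 50) : RelatedBy σ F P P := by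
  induction P with
  | nil => exact fun _ _ _ => rfl
  | succ => exact fun _ _ _ => rfl
  | res x P ih =>
    simp only [allNames, Finset.mem_insert] at h
    exact res (h x (.inl rfl)) (ih fun m hm => h m (.inr hm))
  | par P Q ihP ihQ =>
    simp only [allNames, Finset.mem_union] at h
    exact par (ihP fun m hm => h m (.inl hm)) (ihQ fun m hm => h m (.inr hm))
  | mat a b P ih =>
    simp only [allNames, Finset.mem_insert] at h
    exact mat (.reserved (h a (.inl rfl))) (.reserved (h b (.inr (.inl rfl))))
      (ih fun m hm => h m (.inr (.inr hm)))
  | inp y xs P ih =>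
    simp only [allNames, Finset.mem_insert, Finset.mem_union, List.mem_toFinset] at h
    exact inp (.reserved (h y (.inl rfl))) (fun x hx => h x (.inr (.inl hx)))
      (ih fun m hm => h m (.inr (.inr hm)))
  | rep y xs P ih =>
    simp only [allNames, Finset.mem_insert, Finset.mem_union, List.mem_toFinset] at h
    exact rep (.reserved (h y (.inl rfl))) (fun x hx => h x (.inr (.inl hx)))
      (ih fun m hm => h m (.inr (.inr hm)))
  | out y zs P ih =>
    simp only [allNames, Finset.mem_insert, Finset.mem_union, List.mem_toFinset] at h
    exact out (.reserved (h y (.inl rfl)))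
      (List.forall₂_same.2 fun z hz => .reserved (h z (.inr (.inl hz))))
      (ih fun m hm => h m (.inr (.inr hm)))
  | tau P ih =>
    exact fun ρ ρ' hρ => congrArg DB.tau (ih h ρ ρ' hρ)
  | choice P Q ihP ihQ =>
    simp only [allNames, Finset.mem_union] at h
    exact fun ρ ρ' hρ => congrArg₂ DB.choice
      (ihP (fun m hm => h m (.inl hm)) ρ ρ' hρ) (ihQ (fun m hm => h m (.inr hm)) ρ ρ' hρ)

theorem nil : RelatedBy σ F .nil .nil := fun _ _ _ => rfl

theorem lockTrue {l : Name} (hl : l < 50) : RelatedBy σ F (lockTrue l) (lockTrue l) :=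
  inp (.reserved hl) (by decide) (of_reserved (by decide))

theorem lockFalse {l : Name} (hl : l < 50) : RelatedBy σ F (lockFalse l) (lockFalse l) :=
  inp (.reserved hl) (by decide) (of_reserved (by decide))

theorem test {l : Name} (hl : l < 50) (hP : RelatedBy σ F P P') (hQ : RelatedBy σ F Q Q') :
    RelatedBy σ F (test l P Q) (test l P' Q') :=
  res (by decide) <| res (by decide) <|
    par (out (.reserved hl) (List.forall₂_same.2 fun z hz => .reserved
      ((by decide : ∀ z ∈ [nT, nF], z < 50) z hz)) nil) <|
    par (inp (.reserved (by decide)) (by decide) hP) (inp (.reserved (by decide)) (by decide) hQ)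

theorem encMApar (hP : RelatedBy σ F P P') (hQ : RelatedBy σ F Q Q') :
    RelatedBy σ F (encMApar P Q) (encMApar P' Q') :=
  resList (by decide) <|
    par (res (by decide) <| res (by decide) <| par hP <| of_reserved (by decide)) <|
    par (res (by decide) <| res (by decide) <| par hQ <| of_reserved (by decide)) <|
    of_reserved (by decide)

theorem encMAbranch (hP : RelatedBy σ F P P') :
    RelatedBy σ F (encMAbranch P) (encMAbranch P') :=
  resList (by decide) <|
    par (of_reserved (by decide)) <|
    par (res (by decide) <| res (by decide) <| par hP <| of_reserved (by decide)) <|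
    of_reserved (by decide)

theorem encMArep {x x' y y' : Name} (hy : RenamesTo σ F y y') (hx' : ∀ n ∈ F, σ n ≠ x')
    (hP : RelatedBy (Function.update σ x x') (insert x F) P P') :
    RelatedBy σ F (encMArep y [phiMA x'] P) (encMArep y' [phiMA x] P') := by
  have hx : RenamesTo (Function.update σ x x') (insert x F) (phiMA x') (phiMA x) :=
    .inr ⟨x, Finset.mem_insert_self _ _, by simp, rfl⟩
  refine resList (by decide) <| par ?_ <| par ?_ <| par ?_ <| par ?_ <| par ?_ ?_
  · exact out (.reserved (by decide)) (.cons hy <| .cons (.reserved (by decide)) <|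
      .cons (.reserved (by decide)) .nil) nil
  · refine rep_phiMA (.reserved (by decide)) (by decide) hx' ?_
    exact test (by decide)
      (par (lockFalse (by decide)) <| par (of_reserved (by decide)) <|
        out (.reserved (by decide)) (.cons hx .nil) nil)
      (lockFalse (by decide))
  · exact out (.reserved (by decide)) (.cons hy <| .cons (.reserved (by decide)) <|
      .cons (.reserved (by decide)) .nil) nil
  · exact lockTrue (by decide)
  · exact of_reserved (by decide)
  · exact rep_phiMA (rs := []) (.reserved (by decide)) (by simp) hx' <|
      inp (.reserved (by decide)) (by decide) (encMAbranch hP)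

theorem sum (hP : RelatedBy σ F P P') :
    RelatedBy σ F (.res nL (.par (PiCalc.lockTrue nL) P))
      (.res nL (.par (PiCalc.lockTrue nL) P')) :=
  res (by decide) <| par (lockTrue (by decide)) hP

end RelatedBy

theorem ne_freshName {σ : Name → Name} {avoid F : Finset Name}
    (hσ : ∀ n ∈ F, σ n ∈ avoid) : ∀ n ∈ F, σ n ≠ freshName avoid :=
  fun n hn e => freshName_notMem avoid (e ▸ hσ n hn)

theorem update_freshName_mem {σ : Name → Name} {avoid F : Finset Name}
    (hσ : ∀ n ∈ F, σ n ∈ avoid) (x : Name) :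
    ∀ n ∈ insert x F,
      Function.update σ x (freshName avoid) n ∈ insert (freshName avoid) avoid := by
  intro n hn
  by_cases h : n = x
  · simp [h]
  · have := hσ n ((Finset.mem_insert.1 hn).resolve_left h)
    simp [h, this]

theorem relatedBy_encMAcore {S : Proc} (hS : MonadicInputs S) (σ : Name → Name)
    (avoid F : Finset Name) (hF : freeNames S ⊆ F) (hσ : ∀ n ∈ F, σ n ∈ avoid) :
    RelatedBy σ F (encMAcore (applySubstAux σ avoid S)).1 (encMAcore S).1 ∧
    ∀ l < 50, RelatedBy σ F ((encMAcore (applySubstAux σ avoid S)).2 l) ((encMAcore S).2 l) := by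
  induction S generalizing σ avoid F with
  | nil => exact ⟨.sum .nil, fun _ _ => .nil⟩
  | succ => exact ⟨fun _ _ _ => rfl, fun _ _ => .nil⟩
  | res x P ih =>
    have hP : freeNames P ⊆ insert x F := fun z hz => by
      by_cases h : z = x
      · simp [h]
      · exact Finset.mem_insert_of_mem (hF (by simp [freeNames, hz, h]))
    exact ⟨.res_phiMA (ne_freshName hσ) (ih hS _ _ _ hP (update_freshName_mem hσ x)).1, fun _ _ => .nil⟩
  | par P Q ihP ihQ =>
    obtain ⟨hP, hQ⟩ := Finset.union_subset_iff.1 hF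
    exact ⟨.encMApar (ihP hS.1 _ _ _ hP hσ).1 (ihQ hS.2 _ _ _ hQ hσ).1, fun _ _ => .nil⟩
  | mat a b P ih =>
    simp only [freeNames, Finset.insert_subset_iff] at hF
    exact ⟨.mat (.phiMA hF.1) (.phiMA hF.2.1) (ih hS _ _ _ hF.2.2 hσ).1, fun _ _ => .nil⟩
  | rep y xs P ih =>
    obtain ⟨⟨x, rfl⟩, hS⟩ := hS
    simp only [freeNames, Finset.insert_subset_iff] at hF
    have hP : freeNames P ⊆ insert x F := fun z hz => by
      by_cases h : z = x
      · simp [h]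
      · exact Finset.mem_insert_of_mem (hF.2 (by simp [hz, h]))
    have hrec := (ih hS _ _ _ hP (update_freshName_mem hσ x)).1
    have havoid : insert (freshName avoid) avoid = avoid ∪ [freshName avoid].toFinset := by
      ext; simp [or_comm]
    rw [havoid] at hrec
    exact ⟨.encMArep (.phiMA hF.1) (ne_freshName hσ) hrec, fun _ _ => .nil⟩
  | tau P ih =>
    have h : ∀ l < 50, RelatedBy σ F ((encMAcore (applySubstAux σ avoid (.tau P))).2 l)
        ((encMAcore (.tau P)).2 l) := fun l hl =>
      .test hl (.par (.lockFalse hl) (ih hS _ _ _ hF hσ).1) (.lockFalse hl)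
    exact ⟨.sum (h nL (by decide)), h⟩
  | out y zs P ih =>
    simp only [freeNames, Finset.insert_subset_iff, Finset.union_subset_iff] at hF
    have hzs : List.Forall₂ (RenamesTo σ F) ((zs.map σ).map phiMA) (zs.map phiMA) := by
      rw [List.map_map, List.forall₂_map_left_iff, List.forall₂_map_right_iff]
      exact List.forall₂_same.2 fun z hz => .phiMA (hF.2.1 (List.mem_toFinset.2 hz))
    have h : ∀ l < 50, RelatedBy σ F ((encMAcore (applySubstAux σ avoid (.out y zs P))).2 l)
        ((encMAcore (.out y zs P)).2 l) := fun l hl =>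
      .res (by decide) <| .par
        (.out (.reserved (by decide)) (.cons (.phiMA hF.1) <| .cons (.reserved hl) <|
          .cons (.reserved (by decide)) hzs) .nil)
        (.inp (.reserved (by decide)) (by decide) (ih hS _ _ _ hF.2.2 hσ).1)
    exact ⟨.sum (h nL (by decide)), h⟩
  | inp y xs P ih =>
    obtain ⟨⟨x, rfl⟩, hS⟩ := hS
    simp only [freeNames, Finset.insert_subset_iff] at hF
    have hP : freeNames P ⊆ insert x F := fun z hz => by
      by_cases h : z = x
      · simp [h]
      · exact Finset.mem_insert_of_mem (hF.2 (by simp [hz, h]))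
    have hrec := (ih hS _ _ _ hP (update_freshName_mem hσ x)).1
    have havoid : insert (freshName avoid) avoid = avoid ∪ [freshName avoid].toFinset := by
      ext; simp [or_comm]
    rw [havoid] at hrec
    have h : ∀ l < 50, RelatedBy σ F ((encMAcore (applySubstAux σ avoid (.inp y [x] P))).2 l)
        ((encMAcore (.inp y [x] P)).2 l) := fun l hl =>
      .res (by decide) <| .par
        (.out (.reserved (by decide)) (.cons (.phiMA hF.1) <| .cons (.reserved hl) <|
          .cons (.reserved (by decide)) .nil) .nil)
        (.rep_phiMA (rs := [nL1, nL2, nDash, nS]) (.reserved (by decide)) (by decide) (ne_freshName hσ) <|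
          .test (by decide)
            (.test (by decide)
              (.par (.lockFalse (by decide)) <| .par (.lockFalse (by decide)) <|
                .par (.of_reserved (by decide)) hrec)
              (.of_reserved (by decide)))
            (.lockFalse (by decide)))
    exact ⟨.sum (h nL (by decide)), h⟩
  | choice P Q ihP ihQ =>
    obtain ⟨hP, hQ⟩ := Finset.union_subset_iff.1 hF
    have h : ∀ l < 50, RelatedBy σ F ((encMAcore (applySubstAux σ avoid (.choice P Q))).2 l)
        ((encMAcore (.choice P Q)).2 l) := fun l hl =>
      .par ((ihP hS.1 _ _ _ hP hσ).2 l hl) ((ihQ hS.2 _ _ _ hQ hσ).2 l hl)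
    exact ⟨.sum (h nL (by decide)), h⟩

/-- The substitution on target names induced by `σ`, fixing the reserved names. -/
def liftMA (σ : Name → Name) (m : Name) : Name :=
  if m < 50 then m else phiMA (σ (m - 50))

theorem liftMA_phiMA (σ : Name → Name) (n : Name) : liftMA σ (phiMA n) = phiMA (σ n) := by
  simp [liftMA, phiMA]

/-- The encoding `⟦·⟧ᵐₐ` from the π-calculus with mixed choice into the
asynchronous π-calculus is name invariant: for every source term `S` of πₘ and every
substitution `σ` on names there exists a substitution `σ'` such that
`φᵐₐ(σ(n)) = σ'(φᵐₐ(n))` for every name `n`, and `⟦σ(S)⟧ᵐₐ` is alpha-equivalent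
to `σ'(⟦S⟧ᵐₐ)`. -/
theorem encMA_name_invariant :
    ∀ S : Proc, IsMix S → ∀ σ : Name → Name, ∃ σ' : Name → Name,
      (∀ n : Name, phiMA (σ n) = σ' (phiMA n)) ∧
      AlphaEq (encMA (applySubst σ S)) (applySubst σ' (encMA S)) := by
  intro S hS σ
  refine ⟨liftMA σ, fun n => (liftMA_phiMA σ n).symm, ?_⟩
  have hmem : ∀ n ∈ freeNames S, σ n ∈ allNames S ∪ (allNames S).image σ := fun n hn =>
    Finset.mem_union_right _ (Finset.mem_image_of_mem σ (freeNames_subset_allNames S hn))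
  have henc := (relatedBy_encMAcore hS.monadicInputs σ _ _ subset_rfl hmem).1
  have hlift : ∀ a b, RenamesTo σ (freeNames S) a b → DBName.free a = DBName.free (liftMA σ b) := by
    rintro a b (⟨ha, rfl⟩ | ⟨n, -, rfl, rfl⟩)
    · simp [liftMA, ha]
    · rw [liftMA_phiMA]
  unfold AlphaEq
  rw [toDB_eq_evalDB, toDB_eq_evalDB, dbVar_nil,
    evalDB_applySubst (P := encMA S) (unambiguousBinders_encMAcore hS.monadicInputs).1]
  exact henc _ _ hlift

end PiCalc
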